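/- Let T be a finite tree, let w be an Euler tour of T rooted at a vertex r, let s be a vertex of T with s ≠ r, and let p be the parent edge of s with respect to r. Then an edge e of T lies on the unique path in T from r to s if and only if e_in ≤ p_in and e_out ≥ p_out. -/

import Mathlib

open SimpleGraph

/-- An Euler tour of a graph `G` rooted at `r` is a closed walk from `r` to `r`
whose list of darts contains every dart of `G` exactly once. -/
def SimpleGraph.Walk.IsEulerTour {V : Type*} {G : SimpleGraph V} {r : V}
    (w : G.Walk r r) : Prop :=
  letI : DecidableEq G.Dart := Classical.decEq _
  ∀ d : G.Dart, w.darts.count d = 1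

/-- `EdgeLabels w e i j` says that `i < j` are positions in the dart list of the closed walk
`w` at which darts of the edge `e` occur; for an Euler tour these are the two labels
`e_in = i` and `e_out = j` of the edge `e`. -/
def EdgeLabels {V : Type*} {G : SimpleGraph V} {r : V} (w : G.Walk r r)
    (e : Sym2 V) (i j : ℕ) : Prop :=
  i < j ∧ ∃ (hi : i < w.darts.length) (hj : j < w.darts.length),
    (w.darts.get ⟨i, hi⟩).edge = e ∧ (w.darts.get ⟨j, hj⟩).edge = e

/-- `IsParentEdge w s p p_in p_out` says that `p` is the parent edge of `s` with respect to the
root of the Euler tour `w`, with labels `p_in < p_out`:  `p` is an edge incident to `s` whose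
labels satisfy `p_in ≤ e_in` and `p_out ≥ e_out` for the labels of every edge incident to `s`. -/
def IsParentEdge {V : Type*} {G : SimpleGraph V} {r : V} (w : G.Walk r r)
    (s : V) (p : Sym2 V) (p_in p_out : ℕ) : Prop :=
  p ∈ G.edgeSet ∧ s ∈ p ∧ EdgeLabels w p p_in p_out ∧
    ∀ e ∈ G.edgeSet, s ∈ e → ∀ e_in e_out : ℕ, EdgeLabels w e e_in e_out →
      p_in ≤ e_in ∧ e_out ≤ p_out

namespace SimpleGraph

variable {V : Type*} {G : SimpleGraph V}

theorem IsAcyclic.mem_edges_iff_not_reachable_deleteEdges (hG : G.IsAcyclic) {u v : V}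
    {q : G.Walk u v} (hq : q.IsPath) (e : Sym2 V) :
    e ∈ q.edges ↔ ¬ (G.deleteEdges {e}).Reachable u v := by
  classical
  induction e with | _ a b
  rw [reachable_deleteEdges_iff_exists_walk]
  refine ⟨fun hmem ⟨q', hq'⟩ ↦ hq' ?_, fun h ↦ by_contra fun hmem ↦ h ⟨q, hmem⟩⟩
  have h : q = q'.bypass :=
    congrArg Subtype.val ((hG.subsingleton_path u v).elim ⟨q, hq⟩ ⟨_, q'.bypass_isPath⟩)
  exact q'.edges_bypass_subset_edges (h ▸ hmem)

theorem deleteEdges_reachable_iff_of_adj {u v r : V} {e : Sym2 V} (h : G.Adj u v)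
    (he : s(u, v) ≠ e) :
    (G.deleteEdges {e}).Reachable r u ↔ (G.deleteEdges {e}).Reachable r v := by
  have hadj : (G.deleteEdges {e}).Adj u v := by simpa [deleteEdges_adj] using ⟨h, he⟩
  exact ⟨fun hr ↦ hr.trans hadj.reachable, fun hr ↦ hr.trans hadj.symm.reachable⟩

namespace Walk

variable {r : V} {w : G.Walk r r}

theorem IsEulerTour.get_bijective (hw : w.IsEulerTour) : w.darts.get.Bijective := by
  classical
  exact List.get_bijective_iff.2 fun d ↦ by convert hw d

theorem IsEulerTour.eq_of_getVert_eq (hw : w.IsEulerTour) {i j : ℕ} (hi : i < w.length)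
    (hj : j < w.length) (h₁ : w.getVert i = w.getVert j)
    (h₂ : w.getVert (i + 1) = w.getVert (j + 1)) : i = j := by
  rw [← length_darts] at hi hj
  have h : w.darts.get ⟨i, hi⟩ = w.darts.get ⟨j, hj⟩ := by
    ext <;> simp [darts_getElem_eq_getVert, h₁, h₂]
  exact congrArg Fin.val (hw.get_bijective.injective h)

theorem IsEulerTour.exists_getVert_symm (hw : w.IsEulerTour) {i : ℕ} (hi : i < w.length) :
    ∃ j < w.length, w.getVert j = w.getVert (i + 1) ∧ w.getVert (j + 1) = w.getVert i := by
  obtain ⟨⟨j, hj⟩, h⟩ := hw.get_bijective.surjective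
    ⟨(w.getVert (i + 1), w.getVert i), (w.adj_getVert_succ hi).symm⟩
  refine ⟨j, w.length_darts ▸ hj, ?_⟩
  simpa [darts_getElem_eq_getVert, Dart.ext_iff] using h

end Walk

end SimpleGraph

section EdgeLabels

variable {V : Type*} {G : SimpleGraph V} {r : V} {w : G.Walk r r}

theorem edgeLabels_iff {e : Sym2 V} {i j : ℕ} :
    EdgeLabels w e i j ↔ i < j ∧ j < w.length ∧ s(w.getVert i, w.getVert (i + 1)) = e ∧
      s(w.getVert j, w.getVert (j + 1)) = e := by
  simp only [EdgeLabels, List.get_eq_getElem, Walk.darts_getElem_eq_getVert, Walk.length_darts,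
    Dart.edge_mk]
  constructor
  · rintro ⟨hij, _, hj, h⟩
    exact ⟨hij, hj, h⟩
  · rintro ⟨hij, hj, h⟩
    exact ⟨hij, hij.trans hj, hj, h⟩

theorem EdgeLabels.getVert_symm {e : Sym2 V} {i j : ℕ} (h : EdgeLabels w e i j)
    (hw : w.IsEulerTour) :
    w.getVert j = w.getVert (i + 1) ∧ w.getVert (j + 1) = w.getVert i := by
  obtain ⟨hij, hj, hi', hj'⟩ := edgeLabels_iff.1 h
  obtain ⟨h₁, h₂⟩ | h := Sym2.eq_iff.1 (hj'.trans hi'.symm)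
  · exact absurd (hw.eq_of_getVert_eq hj (hij.trans hj) h₁ h₂) hij.ne'
  · exact h

theorem EdgeLabels.eq_or_eq {e : Sym2 V} {i j k : ℕ} (h : EdgeLabels w e i j)
    (hw : w.IsEulerTour) (hk : k < w.length) (hke : s(w.getVert k, w.getVert (k + 1)) = e) :
    k = i ∨ k = j := by
  obtain ⟨hij, hj, hi', -⟩ := edgeLabels_iff.1 h
  obtain ⟨h₁, h₂⟩ := h.getVert_symm hw
  obtain ⟨h₃, h₄⟩ | ⟨h₃, h₄⟩ := Sym2.eq_iff.1 (hke.trans hi'.symm)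
  · exact .inl (hw.eq_of_getVert_eq hk (hij.trans hj) h₃ h₄)
  · exact .inr (hw.eq_of_getVert_eq hk hj (h₃.trans h₁.symm) (h₄.trans h₂.symm))

theorem SimpleGraph.Walk.IsEulerTour.exists_edgeLabels (hw : w.IsEulerTour) {k : ℕ}
    (hk : k < w.length) :
    ∃ i j, i ≤ k ∧ k ≤ j ∧ EdgeLabels w s(w.getVert k, w.getVert (k + 1)) i j := by
  obtain ⟨l, hl, h₁, h₂⟩ := hw.exists_getVert_symm hk
  have hne : l ≠ k := fun h ↦ (w.adj_getVert_succ hk).ne (by rw [← h₁, h])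
  obtain h | h := hne.lt_or_gt
  · exact ⟨l, k, h.le, le_rfl, edgeLabels_iff.2 ⟨h, hk, by rw [h₁, h₂, Sym2.eq_swap], rfl⟩⟩
  · exact ⟨k, l, le_rfl, h.le, edgeLabels_iff.2 ⟨h, hl, rfl, by rw [h₁, h₂, Sym2.eq_swap]⟩⟩

/-- After deleting an edge of a tree, the part of the Euler tour strictly between the two
traversals of that edge is exactly the part that is disconnected from the root. -/
theorem EdgeLabels.reachable_getVert_iff {e : Sym2 V} {i j : ℕ} (h : EdgeLabels w e i j)
    (hG : G.IsAcyclic) (hw : w.IsEulerTour) {k : ℕ} (hk : k ≤ w.length) :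
    (G.deleteEdges {e}).Reachable r (w.getVert k) ↔ ¬ (i < k ∧ k ≤ j) := by
  obtain ⟨hij, hj, hi', -⟩ := edgeLabels_iff.1 h
  induction k using Nat.strong_induction_on with
  | _ k ih =>
  obtain _ | k := k
  · simp
  by_cases hke : s(w.getVert k, w.getVert (k + 1)) = e
  · have hi : (G.deleteEdges {e}).Reachable r (w.getVert i) :=
      (ih i (by grind [h.eq_or_eq hw hk hke]) (by lia)).2 (by lia)
    obtain rfl | rfl := h.eq_or_eq hw hk hke
    · refine iff_of_false (fun hr ↦ ?_) (by lia)
      have hbridge := isAcyclic_iff_forall_adj_isBridge.1 hG (w.adj_getVert_succ hk)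
      rw [isBridge_iff, hke] at hbridge
      exact hbridge (hi.symm.trans hr)
    · rw [(h.getVert_symm hw).2]
      exact iff_of_true hi (by lia)
  · rw [← deleteEdges_reachable_iff_of_adj (w.adj_getVert_succ hk) hke, ih k (by lia) (by lia)]
    have hi : k ≠ i := by rintro rfl; exact hke hi'
    have hj : k ≠ j := by rintro rfl; exact hke (edgeLabels_iff.1 h).2.2.2
    lia

theorem IsParentEdge.getVert_succ_eq {s : V} {p : Sym2 V} {i j : ℕ} (hp : IsParentEdge w s p i j)
    (hw : w.IsEulerTour) (hs : s ≠ r) : w.getVert (i + 1) = s := by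
  obtain ⟨-, hsp, hlab, hmin⟩ := hp
  obtain ⟨hij, hj, hi', -⟩ := edgeLabels_iff.1 hlab
  rw [← hi', Sym2.mem_iff] at hsp
  refine hsp.resolve_left (fun h ↦ ?_) |>.symm
  obtain _ | i := i
  · exact hs (by simpa using h)
  have hi : i < w.length := by lia
  obtain ⟨a, b, ha, -, hab⟩ := hw.exists_edgeLabels hi
  have := (hmin _ (w.adj_getVert_succ hi) (by simp [h]) a b hab).1
  lia

end EdgeLabels

/-- Let `w` be an Euler tour of a finite tree `T` rooted at `r`, let `s ≠ r`
be a vertex, and let `p` be the parent edge of `s` with respect to `r`, with labels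
`p_in < p_out`.  Then an edge `e` of `T`, with labels `e_in < e_out`, lies on the unique path
in `T` from `r` to `s` iff `e_in ≤ p_in` and `e_out ≥ p_out`. -/
theorem edge_on_root_path_iff {V : Type*} [Fintype V] {T : SimpleGraph V}
    (hT : T.IsTree) {r : V} {w : T.Walk r r} (hw : w.IsEulerTour)
    (s : V) (hs : s ≠ r) {p : Sym2 V} {p_in p_out : ℕ}
    (hp : IsParentEdge w s p p_in p_out)
    {e : Sym2 V} (he : e ∈ T.edgeSet) {e_in e_out : ℕ} (hel : EdgeLabels w e e_in e_out)
    (q : T.Walk r s) (hq : q.IsPath) :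
    e ∈ q.edges ↔ (e_in ≤ p_in ∧ p_out ≤ e_out) := by
  obtain ⟨hab, hb, -⟩ := edgeLabels_iff.1 hp.2.2.1
  have ha : w.getVert (p_in + 1) = s := hp.getVert_succ_eq hw hs
  have hb' : w.getVert p_out = s := (hp.2.2.1.getVert_symm hw).1.trans ha
  have h₁ := hel.reachable_getVert_iff hT.isAcyclic hw (k := p_in + 1) (by lia)
  have h₂ := hel.reachable_getVert_iff hT.isAcyclic hw hb.le
  rw [ha] at h₁
  rw [hb'] at h₂
  rw [hT.isAcyclic.mem_edges_iff_not_reachable_deleteEdges hq]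
  grind
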